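/- Let G^s be an SCG, t ∈ ℤ, and X, Y ∈ V distinct with X an ancestor of Y in G^s; take γ = 1. Assume that the only σ-active (given the empty set) backdoor path ⟨X, V^2, …, V^{n−1}, Y⟩ from X to Y in G^s with {V^2, …, V^{n−1}} ⊆ Desc(X, G^s) is the 2-cycle X ⇄ Y, and that: (i) Cycles^>(X, G^s \ {Y}) = ∅; and (ii) Cycles(Y, G^s) \ {X ⇄ Y} = ∅ (the only directed cycle of G^s through Y is the 2-cycle X ⇄ Y). Then A_1 satisfies the backdoor criterion over all candidate FTCGs relative to ((X, t−1), (Y, t)). (Graph-theoretic form of Lemma 3: P(y_t | do(x_{t−1})) is identifiable by the adjustment set A_1.) -/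

import Mathlib

/-- `u` is an ancestor of `v` (equivalently, `v` is a descendant of `u`):
there is a possibly empty directed path from `u` to `v` in the directed graph
with edge relation `E`. -/
def Anc {α : Type*} (E : α → α → Prop) (u v : α) : Prop :=
  Relation.ReflTransGen E u v

/-- A directed graph is acyclic if there is no nonempty directed path
from a vertex to itself. -/
def Acyclic {α : Type*} (E : α → α → Prop) : Prop :=
  ∀ v, ¬ Relation.TransGen E v v

/-- A path in a directed graph, given as a sequence of `n + 1` pairwise
distinct vertices `w 0, …, w n` (with `n ≥ 1`) together with a chosen
direction for each step: `dir i = true` means the chosen edge is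
`w i → w (i+1)`, and `dir i = false` means it is `w (i+1) → w i`. -/
structure DPath {α : Type*} (E : α → α → Prop) where
  n : ℕ
  pos : 1 ≤ n
  w : ℕ → α
  dir : ℕ → Bool
  inj : ∀ i j, i ≤ n → j ≤ n → w i = w j → i = j
  valid : ∀ i, i < n →
    (dir i = true → E (w i) (w (i + 1))) ∧ (dir i = false → E (w (i + 1)) (w i))

/-- The path runs between `u` and `v`. -/
def DPath.Between {α : Type*} {E : α → α → Prop} (π : DPath E) (u v : α) : Prop :=
  π.w 0 = u ∧ π.w π.n = v

/-- A backdoor path: the first chosen edge points into the first vertex. -/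
def DPath.Backdoor {α : Type*} {E : α → α → Prop} (π : DPath E) : Prop :=
  π.dir 0 = false

/-- The non-endpoint vertex at position `i` is a collider on the path:
both chosen edges at it point into it. -/
def DPath.ColliderAt {α : Type*} {E : α → α → Prop} (π : DPath E) (i : ℕ) : Prop :=
  0 < i ∧ i < π.n ∧ π.dir (i - 1) = true ∧ π.dir i = false

/-- The non-endpoint vertex at position `i` is a definite non-collider:
at least one of the two chosen edges at it points out of it. -/
def DPath.DefNonColliderAt {α : Type*} {E : α → α → Prop} (π : DPath E) (i : ℕ) : Prop :=
  0 < i ∧ i < π.n ∧ (π.dir (i - 1) = false ∨ π.dir i = true)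

/-- A set `Z` blocks a path if some definite non-collider on the path belongs
to `Z`, or some collider on the path has no descendant in `Z`. -/
def Blocks {α : Type*} {E : α → α → Prop} (Z : Set α) (π : DPath E) : Prop :=
  (∃ i, π.DefNonColliderAt i ∧ π.w i ∈ Z) ∨
  (∃ i, π.ColliderAt i ∧ ∀ z ∈ Z, ¬ Anc E (π.w i) z)

/-- Map a path along an inclusion of edge relations (same vertices, same
chosen directions). -/
def DPath.map {α : Type*} {E E' : α → α → Prop} (h : ∀ a b, E a b → E' a b)
    (π : DPath E) : DPath E' where
  n := π.n
  pos := π.pos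
  w := π.w
  dir := π.dir
  inj := π.inj
  valid := fun i hi =>
    ⟨fun hd => h _ _ ((π.valid i hi).1 hd), fun hd => h _ _ ((π.valid i hi).2 hd)⟩

/-- Temporal priority: every edge goes weakly forward in time, and strictly
forward between two instances of the same time series. -/
def TemporalPriority {V : Type*} (F : V × ℤ → V × ℤ → Prop) : Prop :=
  ∀ A B : V, ∀ s t : ℤ, F (A, s) (B, t) → s ≤ t ∧ (A = B → s < t)

/-- Maximal lag `γmax`: every edge has lag at most `γmax`. -/
def MaxLag {V : Type*} (γmax : ℤ) (F : V × ℤ → V × ℤ → Prop) : Prop :=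
  ∀ A B : V, ∀ s t : ℤ, F (A, s) (B, t) → t - s ≤ γmax

/-- Consistency throughout time: the edge relation is invariant under
simultaneous time shifts. -/
def ConsistentThroughTime {V : Type*} (F : V × ℤ → V × ℤ → Prop) : Prop :=
  ∀ A B : V, ∀ s t k : ℤ, F (A, s) (B, t) ↔ F (A, s + k) (B, t + k)

/-- The extended summary causal graph (ESCG) derived from an FTCG `F`:
vertices `Sum.inl A` represent `A_{t^-}` (past slice) and `Sum.inr A`
represent `A_t` (present slice). -/
def derivedESCG {V : Type*} (γmax : ℤ) (F : V × ℤ → V × ℤ → Prop) :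
    (V ⊕ V) → (V ⊕ V) → Prop
  | Sum.inr A, Sum.inr B => F (A, 0) (B, 0)
  | Sum.inl A, Sum.inr B => ∃ γ : ℤ, 1 ≤ γ ∧ γ ≤ γmax ∧ F (A, -γ) (B, 0)
  | _, _ => False

/-- A candidate FTCG for an ESCG `e`: an FTCG satisfying temporal priority,
maximal lag `γmax`, consistency throughout time and acyclicity whose derived
ESCG is `e`. -/
def CandidateESCG {V : Type*} (γmax : ℤ) (e : (V ⊕ V) → (V ⊕ V) → Prop)
    (F : V × ℤ → V × ℤ → Prop) : Prop :=
  TemporalPriority F ∧ MaxLag γmax F ∧ ConsistentThroughTime F ∧ Acyclic F ∧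
    derivedESCG γmax F = e

/-- The summary causal graph (SCG) derived from an FTCG `F`. -/
def derivedSCG {V : Type*} (γmax : ℤ) (F : V × ℤ → V × ℤ → Prop) : V → V → Prop :=
  fun A B => ∃ t γ : ℤ, 0 ≤ γ ∧ γ ≤ γmax ∧ F (A, t - γ) (B, t)

/-- A candidate FTCG for an SCG `S`. -/
def CandidateSCG {V : Type*} (γmax : ℤ) (S : V → V → Prop)
    (F : V × ℤ → V × ℤ → Prop) : Prop :=
  TemporalPriority F ∧ MaxLag γmax F ∧ ConsistentThroughTime F ∧ Acyclic F ∧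
    derivedSCG γmax F = S

/-- The densest candidate FTCG for an ESCG `e`. -/
def densestFTCG {V : Type*} (γmax : ℤ) (e : (V ⊕ V) → (V ⊕ V) → Prop) :
    V × ℤ → V × ℤ → Prop :=
  fun p q =>
    (p.2 = q.2 ∧ e (Sum.inr p.1) (Sum.inr q.1)) ∨
    (∃ ℓ : ℤ, 1 ≤ ℓ ∧ ℓ ≤ γmax ∧ p.2 = q.2 - ℓ ∧ e (Sum.inl p.1) (Sum.inr q.1))

/-- The adjustment set `B_γ` for an ESCG `e`, variable `X`, time `t`, lag `γ`. -/
def Bset {V : Type*} (γmax : ℤ) (e : (V ⊕ V) → (V ⊕ V) → Prop)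
    (X : V) (t γ : ℤ) : Set (V × ℤ) :=
  {p | (∃ ℓ : ℤ, 1 ≤ ℓ ∧ ℓ ≤ γmax ∧ p.2 = t - γ - ℓ ∧ e (Sum.inl p.1) (Sum.inr X)) ∨
       (p.2 = t - γ ∧ e (Sum.inr p.1) (Sum.inr X))}

/-- The adjustment set `A_γ` for an SCG `S`, variable `X`, time `t`, lag `γ`. -/
def Aset {V : Type*} (γmax : ℤ) (S : V → V → Prop) (X : V) (t γ : ℤ) :
    Set (V × ℤ) :=
  {p | (∃ ℓ : ℤ, 1 ≤ ℓ ∧ ℓ ≤ γmax ∧ p.2 = t - γ - ℓ ∧ Anc S X p.1) ∨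
       (∃ ℓ : ℤ, 0 ≤ ℓ ∧ ℓ ≤ γmax ∧ p.2 = t - γ - ℓ ∧ ¬ Anc S X p.1)}

/-- `Z` satisfies the backdoor criterion over all candidate FTCGs (described
by the predicate `Cand`) relative to `(x, y)`. -/
def SatisfiesBackdoorCriterionAll {V : Type*}
    (Cand : (V × ℤ → V × ℤ → Prop) → Prop)
    (Z : Set (V × ℤ)) (x y : V × ℤ) : Prop :=
  x ∉ Z ∧ y ∉ Z ∧
    ∀ F, Cand F →
      (∀ π : DPath F, π.Between x y → π.Backdoor → Blocks Z π) ∧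
      (∀ p ∈ Z, ¬ Anc F x p)

/-- The standard backdoor criterion relative to `(x, y)` in a single directed
graph: no element of `Z` is a descendant of `x`, and `Z` blocks every
backdoor path between `x` and `y`. -/
def StdBackdoorCriterion {α : Type*} (E : α → α → Prop) (Z : Set α)
    (x y : α) : Prop :=
  (∀ p ∈ Z, ¬ Anc E x p) ∧
  (∀ π : DPath E, π.Between x y → π.Backdoor → Blocks Z π)

/-- The non-endpoint vertex at position `i` σ-blocks the path given the empty
set: the edge into it from its predecessor is present but not reversible, and
likewise from its successor. -/
def DPath.SigmaBlockedAt {α : Type*} {E : α → α → Prop} (π : DPath E) (i : ℕ) : Prop :=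
  0 < i ∧ i < π.n ∧
    (E (π.w (i - 1)) (π.w i) ∧ ¬ E (π.w i) (π.w (i - 1))) ∧
    (E (π.w (i + 1)) (π.w i) ∧ ¬ E (π.w i) (π.w (i + 1)))

/-- A path is σ-active given the empty set if no non-endpoint vertex
σ-blocks it. -/
def DPath.SigmaActive {α : Type*} {E : α → α → Prop} (π : DPath E) : Prop :=
  ∀ i, ¬ π.SigmaBlockedAt i

/-- A directed cycle: vertices `w 0, …, w (m-1)` pairwise distinct, with
`w m = w 0` and edges `w i → w (i+1)`; `m = 1` is a self-loop. -/
structure DCycle {α : Type*} (E : α → α → Prop) where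
  m : ℕ
  pos : 1 ≤ m
  w : ℕ → α
  ret : w m = w 0
  inj : ∀ i j, i < m → j < m → w i = w j → i = j
  valid : ∀ i, i < m → E (w i) (w (i + 1))

/-- The cycle passes through `x`. -/
def DCycle.Through {α : Type*} {E : α → α → Prop} (c : DCycle E) (x : α) : Prop :=
  ∃ i, i < c.m ∧ c.w i = x

/-- `Cycles^>(x, E) ≠ ∅`: there is a directed cycle through `x` with at least
two distinct vertices. -/
def HasBigCycleThrough {α : Type*} (E : α → α → Prop) (x : α) : Prop :=
  ∃ c : DCycle E, c.Through x ∧ 2 ≤ c.m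

/-- The graph obtained by removing vertex `y` and all incident edges. -/
def delVertex {α : Type*} (E : α → α → Prop) (y : α) : α → α → Prop :=
  fun a b => a ≠ y ∧ b ≠ y ∧ E a b

/-- The cycle is the 2-cycle `x ⇄ y`. -/
def DCycle.IsTwoCycle {α : Type*} {E : α → α → Prop} (c : DCycle E) (x y : α) : Prop :=
  c.m = 2 ∧ ((c.w 0 = x ∧ c.w 1 = y) ∨ (c.w 0 = y ∧ c.w 1 = x))

/-- `a` and `b` lie on a common directed cycle of `E`
(`b` lies on a directed cycle through `a`). -/
def OnCommonCycle {α : Type*} (E : α → α → Prop) (a b : α) : Prop :=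
  ∃ c : DCycle E, c.Through a ∧ c.Through b

/-- A path `πf` in a candidate FTCG is compatible with a path `πs` in the SCG
`S` if every intermediate vertex `(W, u)` of `πf` satisfies: `W` is an
intermediate vertex of `πs`, or `W` lies on a directed cycle of `S` through
some intermediate vertex of `πs` but on no directed cycle of `S` through `X`. -/
def Compatible {V : Type*} {F : V × ℤ → V × ℤ → Prop} (S : V → V → Prop) (X : V)
    (πf : DPath F) (πs : DPath S) : Prop :=
  ∀ i, 0 < i → i < πf.n →
    (∃ j, 0 < j ∧ j < πs.n ∧ πs.w j = (πf.w i).1) ∨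
    (∃ j, 0 < j ∧ j < πs.n ∧ OnCommonCycle S (πs.w j) (πf.w i).1 ∧
      ¬ OnCommonCycle S X (πf.w i).1)

/-- A path in a candidate FTCG between `(X, t−γ)` and `(Y, t)` is ambiguous if
all its vertices are at times `≥ t − γ`. -/
def DPath.Ambiguous {V : Type*} {F : V × ℤ → V × ℤ → Prop} (π : DPath F)
    (t γ : ℤ) : Prop :=
  ∀ i, i ≤ π.n → t - γ ≤ (π.w i).2

/-- Two vertices joined by a directed path are joined by a directed path without repetitions. -/
theorem Anc.exists_simple_path {α : Type*} {E : α → α → Prop} {a b : α} (h : Anc E a b) :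
    ∃ (n : ℕ) (w : ℕ → α), w 0 = a ∧ w n = b ∧
      (∀ i j, i ≤ n → j ≤ n → w i = w j → i = j) ∧ ∀ i, i < n → E (w i) (w (i + 1)) := by
  induction h with
  | refl => exact ⟨0, fun _ => a, rfl, rfl, by omega, by omega⟩
  | @tail b c _ hbc ih =>
    obtain ⟨n, w, h0, hn, hinj, hE⟩ := ih
    by_cases hc : ∃ i ≤ n, w i = c
    · obtain ⟨i, hi, hic⟩ := hc
      exact ⟨i, w, h0, hic, fun j k hj hk => hinj j k (by omega) (by omega),
        fun j hj => hE j (by omega)⟩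
    · push Not at hc
      refine ⟨n + 1, fun i => if i ≤ n then w i else c, by simpa using h0, by simp, ?_, ?_⟩
      · intro i j hi hj hij
        by_cases hin : i ≤ n <;> by_cases hjn : j ≤ n <;> simp only [hin, hjn, if_true, if_false] at hij
        · exact hinj i j hin hjn hij
        · exact absurd hij (hc i hin)
        · exact absurd hij.symm (hc j hjn)
        · omega
      · intro i hi
        have hin : i ≤ n := by omega
        by_cases hin' : i + 1 ≤ n
        · simpa [hin, hin'] using hE i (by omega)
        · obtain rfl : i = n := by omega
          simpa [hn] using hbc

/-- An edge closing up a directed path yields a directed cycle starting with that path's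
first vertex and traversing the edge last. -/
theorem Anc.exists_cycle {α : Type*} {E : α → α → Prop} {a b : α} (h : Anc E a b) (hba : E b a) :
    ∃ c : DCycle E, c.w 0 = a ∧ c.w (c.m - 1) = b := by
  obtain ⟨n, w, h0, hn, hinj, hE⟩ := h.exists_simple_path
  refine ⟨⟨n + 1, by omega, fun i => if i ≤ n then w i else a, by simp [h0], ?_, ?_⟩,
    by simpa using h0, by simpa using hn⟩
  · intro i j hi hj hij
    have hin : i ≤ n := by omega
    have hjn : j ≤ n := by omega
    simp only [hin, hjn, if_true] at hij
    exact hinj i j hin hjn hij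
  · intro i hi
    have hin : i ≤ n := by omega
    by_cases hin' : i + 1 ≤ n
    · simpa [hin, hin'] using hE i (by omega)
    · obtain rfl : i = n := by omega
      simpa [hn] using hba

/-- If every cycle through `y` is the 2-cycle `x ⇄ y`, then `x` is the only parent of `y`
among the descendants of `y`. -/
theorem eq_of_edge_of_cycles_two {α : Type*} {E : α → α → Prop} {x y v : α} (hxy : x ≠ y)
    (h : ∀ c : DCycle E, c.Through y → c.IsTwoCycle x y) (hyv : Anc E y v) (hv : E v y) :
    v = x := by
  obtain ⟨c, h0, h1⟩ := hyv.exists_cycle hv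
  obtain ⟨hm, hc⟩ := h c ⟨0, c.pos, h0⟩
  rw [hm] at h1
  rcases hc with ⟨hx, -⟩ | ⟨-, hx⟩
  · exact absurd (hx.symm.trans h0) hxy
  · exact h1.symm.trans hx

/-- If every cycle through `y` is the 2-cycle `x ⇄ y`, then `x` is the only child of `y`
among the ancestors of `y`. -/
theorem eq_of_edge_of_cycles_two' {α : Type*} {E : α → α → Prop} {x y v : α} (hxy : x ≠ y)
    (h : ∀ c : DCycle E, c.Through y → c.IsTwoCycle x y) (hvy : Anc E v y) (hv : E y v) :
    v = x := by
  obtain ⟨c, h0, h1⟩ := hvy.exists_cycle hv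
  obtain ⟨hm, hc⟩ := h c ⟨c.m - 1, Nat.sub_lt c.pos one_pos, h1⟩
  rw [hm] at h1
  rcases hc with ⟨hx, -⟩ | ⟨-, hx⟩
  · exact h0.symm.trans hx
  · exact absurd (hx.symm.trans h1) hxy

/-- If the only cycles of at least two vertices through `x` use `y`, and every cycle through `y`
is the 2-cycle `x ⇄ y`, then `y` is the only parent of `x`, other than `x`, among the descendants
of `x`. -/
theorem eq_of_edge_of_not_hasBigCycleThrough {α : Type*} {E : α → α → Prop} {x y v : α}
    (hbig : ¬ HasBigCycleThrough (delVertex E y) x)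
    (h : ∀ c : DCycle E, c.Through y → c.IsTwoCycle x y) (hxv : Anc E x v) (hv : E v x)
    (hne : v ≠ x) : v = y := by
  obtain ⟨c, h0, h1⟩ := hxv.exists_cycle hv
  have hm : 2 ≤ c.m := by
    by_contra hlt
    have := c.pos
    rw [show c.m - 1 = 0 by omega, h0] at h1
    exact hne h1.symm
  by_cases hy : c.Through y
  · obtain ⟨hm2, hc⟩ := h c hy
    rw [hm2] at h1
    rcases hc with ⟨-, hc⟩ | ⟨-, hc⟩
    · exact h1.symm.trans hc
    · exact absurd (h1.symm.trans hc) hne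
  · have hwy : ∀ i, i ≤ c.m → c.w i ≠ y := by
      intro i hi hiy
      rcases hi.lt_or_eq with hlt | rfl
      · exact hy ⟨i, hlt, hiy⟩
      · exact hy ⟨0, c.pos, c.ret ▸ hiy⟩
    exact absurd ⟨⟨c.m, c.pos, c.w, c.ret, c.inj, fun i hi =>
      ⟨hwy i hi.le, hwy (i + 1) hi, c.valid i hi⟩⟩, ⟨0, c.pos, h0⟩, hm⟩ hbig

/-- An edge of a candidate FTCG projects to an edge of the SCG. -/
theorem CandidateSCG.edge {V : Type*} {γmax : ℤ} {S : V → V → Prop}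
    {F : V × ℤ → V × ℤ → Prop} (hF : CandidateSCG γmax S F) {p q : V × ℤ} (h : F p q) :
    S p.1 q.1 := by
  obtain ⟨htp, hml, -, -, rfl⟩ := hF
  have hle := (htp _ _ _ _ h).1
  have hlag := hml _ _ _ _ h
  refine ⟨q.2, q.2 - p.2, by omega, hlag, ?_⟩
  simpa using h

/-- A directed path of a candidate FTCG projects to a directed path of the SCG. -/
theorem CandidateSCG.anc_fst {V : Type*} {γmax : ℤ} {S : V → V → Prop}
    {F : V × ℤ → V × ℤ → Prop} (hF : CandidateSCG γmax S F) {p q : V × ℤ} (h : Anc F p q) :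
    Anc S p.1 q.1 := by
  induction h with
  | refl => exact Relation.ReflTransGen.refl
  | tail _ hbc ih => exact ih.tail (hF.edge hbc)

/-- Directed paths go weakly forward in time. -/
theorem TemporalPriority.anc_snd_le {V : Type*} {F : V × ℤ → V × ℤ → Prop}
    (hF : TemporalPriority F) {p q : V × ℤ} (h : Anc F p q) : p.2 ≤ q.2 := by
  induction h with
  | refl => exact le_rfl
  | tail _ hbc ih => exact ih.trans (hF _ _ _ _ hbc).1

/-- No element of `A_γ` descends from a vertex at time at least `t - γ` of a descendant
of `X`. -/
theorem CandidateSCG.not_anc_of_mem_Aset {V : Type*} {γmax : ℤ} {S : V → V → Prop}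
    {F : V × ℤ → V × ℤ → Prop} (hF : CandidateSCG γmax S F) {X : V} {t γ : ℤ} {p q : V × ℤ}
    (hp : Anc S X p.1) (hpt : t - γ ≤ p.2) (hq : q ∈ Aset γmax S X t γ) : ¬ Anc F p q := by
  intro h
  have hle := hF.1.anc_snd_le h
  rcases hq with ⟨ℓ, h1, -, h3, -⟩ | ⟨ℓ, -, -, -, h4⟩
  · omega
  · exact h4 (hp.trans (hF.anc_fst h))

/-- A parent, in a candidate FTCG, of a vertex at time `t - γ` either belongs to `A_γ`, or is
a vertex at time `t - γ` of a descendant of `X`. -/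
theorem CandidateSCG.parent_mem_Aset_or {V : Type*} {γmax : ℤ} {S : V → V → Prop}
    {F : V × ℤ → V × ℤ → Prop} (hF : CandidateSCG γmax S F) {X : V} {t γ : ℤ} {p q : V × ℤ}
    (h : F p q) (hq : q.2 = t - γ) :
    p ∈ Aset γmax S X t γ ∨ (p.2 = t - γ ∧ Anc S X p.1) := by
  have hle := (hF.1 _ _ _ _ h).1
  have hlag := hF.2.1 _ _ _ _ h
  by_cases hd : Anc S X p.1
  · rcases hle.lt_or_eq with hlt | heq
    · exact Or.inl (Or.inl ⟨t - γ - p.2, by omega, by omega, by omega, hd⟩)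
    · exact Or.inr ⟨by omega, hd⟩
  · exact Or.inl (Or.inr ⟨t - γ - p.2, by omega, by omega, by omega, hd⟩)

/-- A path which is not blocked by `Z` and leaves its vertex `w k` along an outgoing edge, where
no vertex in `Z` descends from `w (k + 1)`, is directed from there on. -/
theorem DPath.anc_of_not_blocks {α : Type*} {E : α → α → Prop} {π : DPath E} {Z : Set α}
    (hb : ¬ Blocks Z π) {k : ℕ} (hk : π.dir k = true)
    (hZ : ∀ z ∈ Z, ¬ Anc E (π.w (k + 1)) z) (i : ℕ) (hki : k + 1 ≤ i) (hi : i ≤ π.n) :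
    Anc E (π.w (k + 1)) (π.w i) := by
  have key : ∀ j, k + 1 ≤ j → j ≤ π.n →
      π.dir (j - 1) = true ∧ Anc E (π.w (k + 1)) (π.w j) := by
    intro j hj
    induction j, hj using Nat.le_induction with
    | base => exact fun _ => ⟨hk, Relation.ReflTransGen.refl⟩
    | succ j hj ih =>
      intro hjn
      obtain ⟨hd, ha⟩ := ih (by omega)
      have hdj : π.dir j = true := by
        by_contra hfalse
        exact hb (Or.inr ⟨j, ⟨by omega, by omega, hd, by simpa using hfalse⟩,
          fun z hz haz => hZ z hz (ha.trans haz)⟩)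
      exact ⟨hdj, ha.tail ((π.valid j (by omega)).1 hdj)⟩
  exact (key i hki hi).2

/-- Lemma 3, graph-theoretic form: if the only σ-active
backdoor path from `X` to `Y` with intermediate vertices in `Desc(X)` is the
2-cycle `X ⇄ Y`, `Cycles^>(X, G^s∖{Y}) = ∅` and the only directed cycle
through `Y` is `X ⇄ Y`, then `A_1` satisfies the backdoor criterion over all
candidate FTCGs relative to `((X, t−1), (Y, t))`. -/
theorem lemma3_Aset_backdoor_criterion {V : Type*} [Fintype V] [Nonempty V]
    (γmax : ℤ) (hγmax : 1 ≤ γmax)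
    (S : V → V → Prop) (X Y : V) (hXY : X ≠ Y) (hanc : Anc S X Y) (t : ℤ)
    (hXYe : S X Y) (hYXe : S Y X)
    (honly : ∀ πs : DPath S, πs.Between X Y → πs.Backdoor → πs.SigmaActive →
      (∀ i, 0 < i → i < πs.n → Anc S X (πs.w i)) → πs.n = 1)
    (h1 : ¬ HasBigCycleThrough (delVertex S Y) X)
    (h2 : ∀ c : DCycle S, c.Through Y → c.IsTwoCycle X Y) :
    SatisfiesBackdoorCriterionAll (CandidateSCG γmax S)
      (Aset γmax S X t 1) (X, t - 1) (Y, t) := by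
  refine ⟨?_, ?_, fun F hF => ⟨?_, fun p hp =>
    hF.not_anc_of_mem_Aset Relation.ReflTransGen.refl le_rfl hp⟩⟩
  · rintro (⟨ℓ, h1, -, h3, -⟩ | ⟨ℓ, -, -, -, h4⟩)
    · simp only at h3
      omega
    · exact h4 Relation.ReflTransGen.refl
  · rintro (⟨ℓ, h1, -, h3, -⟩ | ⟨ℓ, h1, -, h3, -⟩) <;> (simp only at h3; omega)
  rintro π ⟨hw0, hwn⟩ hbd
  by_contra hb
  have hn0 := π.pos
  have hedge0 : F (π.w 1) (X, t - 1) := hw0 ▸ (π.valid 0 (by omega)).2 hbd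
  have htp0 : (π.w 1).2 ≤ t - 1 ∧ ((π.w 1).1 = X → (π.w 1).2 < t - 1) := hF.1 _ _ _ _ hedge0
  have hn : 1 < π.n := by
    rcases (show 1 ≤ π.n from hn0).lt_or_eq with h | h
    · exact h
    · rw [h, hwn] at htp0
      have := htp0.1
      simp only at this
      omega
  have hw1 : π.w 1 = (Y, t - 1) := by
    rcases hF.parent_mem_Aset_or (X := X) (γ := 1) hedge0 rfl with h | ⟨ht, hd⟩
    · exact absurd (Or.inl ⟨1, ⟨one_pos, hn, Or.inl hbd⟩, h⟩) hb
    · refine Prod.ext (eq_of_edge_of_not_hasBigCycleThrough h1 h2 hd (hF.edge hedge0) ?_) ht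
      intro hX
      have := htp0.2 hX
      omega
  have hne0 : ∀ i, i ≤ π.n → π.w i = (X, t - 1) → i = 0 := fun i hi h =>
    π.inj i 0 hi (by omega) (h.trans hw0.symm)
  have hdir1 : π.dir 1 = true := by
    by_contra hdir
    have hdir : π.dir 1 = false := by simpa using hdir
    have hedge1 : F (π.w 2) (Y, t - 1) := hw1 ▸ (π.valid 1 hn).2 hdir
    rcases hF.parent_mem_Aset_or (X := X) (γ := 1) hedge1 rfl with h | ⟨ht, hd⟩
    · by_cases h2n : π.n = 2
      · rw [← h2n, hwn] at hedge1
        have := (hF.1 _ _ _ _ hedge1).1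
        omega
      · exact hb (Or.inl ⟨2, ⟨two_pos, by omega, Or.inl hdir⟩, h⟩)
    · have hX : (π.w 2).1 = X := eq_of_edge_of_cycles_two hXY h2
        ((Relation.ReflTransGen.single hYXe).trans hd) (hF.edge hedge1)
      have := hne0 2 hn (Prod.ext hX ht)
      omega
  have hedge1 : F (Y, t - 1) (π.w 2) := hw1 ▸ (π.valid 1 hn).1 hdir1
  have htp1 : t - 1 ≤ (π.w 2).2 := (hF.1 _ _ _ _ hedge1).1
  have hanc2 : Anc F (π.w 2) (Y, t) := by
    rw [← hwn]
    exact π.anc_of_not_blocks hb hdir1 (fun z hz => hF.not_anc_of_mem_Aset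
      (hanc.tail (hF.edge hedge1)) htp1 hz) π.n hn le_rfl
  have hX : (π.w 2).1 = X :=
    eq_of_edge_of_cycles_two' hXY h2 (hF.anc_fst hanc2) (hF.edge hedge1)
  have ht : (π.w 2).2 = t := by
    have hle : (π.w 2).2 ≤ t := hF.1.anc_snd_le hanc2
    have hne : (π.w 2).2 ≠ t - 1 := fun h => by
      have := hne0 2 hn (Prod.ext hX h)
      omega
    omega
  have hXt : π.w 2 = (X, t) := Prod.ext hX ht
  rw [hw1] at hedge0
  have hshift : F (Y, t) (X, t) := by
    simpa using (hF.2.2.1 Y X (t - 1) (t - 1) 1).1 hedge0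
  exact hF.2.2.2.1 _ (Relation.TransGen.tail' (hXt ▸ hanc2) hshift)
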